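/- arXiv:2004.12082 — 6 statements merged into one kernel-verified Lean document; each statement's English description precedes it below -/
import Mathlib

section
/- Let f : ℝ^{m×(n+1)} → ℝ^n be Fréchet differentiable at H₀ = [A b] with derivative ΔH ↦ M·vec(ΔH) for some matrix M ∈ ℝ^{n×m(n+1)}, and suppose x = f(H₀) has ‖x‖_∞ ≠ 0. Then the limit as ε → 0⁺ of (1/(ε‖x‖_∞))·sup{ ‖f(H₀+ΔH) − f(H₀)‖_∞ : ΔH ∈ ℝ^{m×(n+1)}, |ΔH| ≤ ε|H₀| entrywise } exists and equals ‖ |M|·vec([|A| |b|]) ‖_∞ / ‖x‖_∞. (This is the explicit expression for the mixed condition number m(A,b) of the truncated total least squares solution, where f = ψ_k and M = M_k is its Fréchet derivative matrix.) -/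
open Matrix Filter

/-- `vec` of the augmented matrix `[A b] ∈ ℝ^{m×(n+1)}`, as a vector indexed by
(row, column) pairs. -/
noncomputable def augVec {m n : ℕ} (A : Matrix (Fin m) (Fin n) ℝ) (b : Fin m → ℝ) :
    Fin m × Fin (n + 1) → ℝ :=
  fun p => Fin.lastCases (b p.1) (fun j => A p.1 j) p.2

/-- The entrywise bound `|M v| ≤ |M| |v|`, scaled and in the sup norm. -/
theorem norm_mulVec_le_of_abs_le {ι κ : Type*} [Fintype ι] [Fintype κ]
    (M : Matrix κ ι ℝ) (h v : ι → ℝ) {ε : ℝ} (hε : 0 ≤ ε) (hv : ∀ p, |v p| ≤ ε * |h p|) :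
    ‖M *ᵥ v‖ ≤ ε * ‖(M.map fun y => |y|) *ᵥ fun p => |h p|‖ := by
  refine (pi_norm_le_iff_of_nonneg (by positivity)).2 fun i => ?_
  calc ‖(M *ᵥ v) i‖ = |∑ p, M i p * v p| := rfl
    _ ≤ ∑ p, |M i p * v p| := Finset.abs_sum_le_sum_abs _ _
    _ ≤ ∑ p, ε * (|M i p| * |h p|) := by
        refine Finset.sum_le_sum fun p _ => ?_
        rw [abs_mul, mul_left_comm]
        exact mul_le_mul_of_nonneg_left (hv p) (abs_nonneg _)
    _ = ε * ((M.map fun y => |y|) *ᵥ fun p => |h p|) i := by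
        rw [← Finset.mul_sum]; rfl
    _ ≤ _ := mul_le_mul_of_nonneg_left
        ((Real.le_norm_self _).trans (norm_le_pi_norm _ i)) hε

/-- A choice of signs attains the bound `norm_mulVec_le_of_abs_le`. -/
theorem exists_abs_le_norm_mulVec_ge {ι κ : Type*} [Fintype ι] [Fintype κ]
    (M : Matrix κ ι ℝ) (h : ι → ℝ) {ε : ℝ} (hε : 0 ≤ ε) :
    ∃ v : ι → ℝ, (∀ p, |v p| ≤ ε * |h p|) ∧
      ε * ‖(M.map fun y => |y|) *ᵥ fun p => |h p|‖ ≤ ‖M *ᵥ v‖ := by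
  rcases isEmpty_or_nonempty κ with hκ | hκ
  · refine ⟨0, fun p => by simpa using by positivity, ?_⟩
    rw [Subsingleton.elim ((M.map fun y => |y|) *ᵥ fun p => |h p|) 0]
    simp
  obtain ⟨i, hi⟩ := Finite.exists_max fun i => ‖((M.map fun y => |y|) *ᵥ fun p => |h p|) i‖
  refine ⟨fun p => SignType.sign (M i p) * (ε * |h p|), fun p => ?_, ?_⟩
  · rw [abs_mul, abs_of_nonneg (by positivity : 0 ≤ ε * |h p|)]
    refine mul_le_of_le_one_left (by positivity) ?_
    rcases lt_trichotomy (M i p) 0 with hp | hp | hp <;> simp [hp]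
  · have hrow : (M *ᵥ fun p => SignType.sign (M i p) * (ε * |h p|)) i
        = ε * ((M.map fun y => |y|) *ᵥ fun p => |h p|) i := by
      simp only [Matrix.mulVec, dotProduct, Matrix.map_apply, Finset.mul_sum]
      refine Finset.sum_congr rfl fun p _ => ?_
      rw [← mul_assoc, self_mul_sign]
      ring
    calc _ ≤ ε * ‖((M.map fun y => |y|) *ᵥ fun p => |h p|) i‖ :=
          mul_le_mul_of_nonneg_left ((pi_norm_le_iff_of_nonempty _).2 hi) hε
      _ = ‖(M *ᵥ fun p => SignType.sign (M i p) * (ε * |h p|)) i‖ := by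
          rw [hrow, norm_mul, Real.norm_of_nonneg hε]
      _ ≤ _ := norm_le_pi_norm _ i

/-- The largest change of `f` under entrywise relative perturbations of size `ε` of `h` is
`ε ‖|M| |h|‖ + o(ε)`, where `M` is the Jacobian matrix of `f` at `h`. -/
theorem tendsto_sSup_relative_perturbation {ι κ : Type*} [Fintype ι] [Fintype κ]
    {f : (ι → ℝ) → (κ → ℝ)} {h : ι → ℝ} {M : Matrix κ ι ℝ} {L : (ι → ℝ) →L[ℝ] (κ → ℝ)}
    (hL : ∀ v, L v = M *ᵥ v) (hf : HasFDerivAt f L h) :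
    Tendsto
      (fun ε : ℝ => ε⁻¹ *
        sSup {r : ℝ | ∃ v : ι → ℝ, (∀ p, |v p| ≤ ε * |h p|) ∧ r = ‖f (h + v) - f h‖})
      (nhdsWithin 0 (Set.Ioi 0))
      (nhds ‖(M.map fun y => |y|) *ᵥ fun p => |h p|‖) := by
  set K := ‖(M.map fun y => |y|) *ᵥ fun p => |h p|‖
  rw [Metric.tendsto_nhds]
  intro η hη
  have hh : 0 < ‖h‖ + 1 := by positivity
  set c := η / 2 / (‖h‖ + 1) with hc
  have hc0 : 0 < c := by positivity
  obtain ⟨δ, hδ, hball⟩ := Metric.eventually_nhds_iff.1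
    ((hasFDerivAt_iff_isLittleO_nhds_zero.1 hf).def hc0)
  filter_upwards [Ioo_mem_nhdsGT (show 0 < δ / (‖h‖ + 1) by positivity)] with ε hε
  obtain ⟨hε0, hε1⟩ := hε
  rw [lt_div_iff₀ hh] at hε1
  have herr : ∀ v : ι → ℝ, (∀ p, |v p| ≤ ε * |h p|) →
      ‖f (h + v) - f h - M *ᵥ v‖ ≤ ε * (η / 2) := by
    intro v hv
    have hvn : ‖v‖ ≤ ε * (‖h‖ + 1) := by
      refine (pi_norm_le_iff_of_nonneg (by positivity)).2 fun p => (hv p).trans ?_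
      have := norm_le_pi_norm h p
      rw [Real.norm_eq_abs] at this
      gcongr
      linarith
    have := hball (y := v) (by rw [dist_zero_right]; exact hvn.trans_lt hε1)
    rw [hL] at this
    calc _ ≤ c * ‖v‖ := this
      _ ≤ c * (ε * (‖h‖ + 1)) := by gcongr
      _ = ε * (η / 2) := by rw [hc]; field_simp
  set S := {r : ℝ | ∃ v : ι → ℝ, (∀ p, |v p| ≤ ε * |h p|) ∧ r = ‖f (h + v) - f h‖}
  have hub : ∀ r ∈ S, r ≤ ε * K + ε * (η / 2) := by
    rintro r ⟨v, hv, rfl⟩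
    have h1 := norm_mulVec_le_of_abs_le M h v hε0.le hv
    have h2 := norm_le_norm_add_norm_sub' (f (h + v) - f h) (M *ᵥ v)
    linarith [herr v hv]
  obtain ⟨v, hv, hvK⟩ := exists_abs_le_norm_mulVec_ge M h hε0.le
  have hmem : ‖f (h + v) - f h‖ ∈ S := ⟨v, hv, rfl⟩
  have hupper : sSup S ≤ ε * K + ε * (η / 2) := csSup_le ⟨_, hmem⟩ hub
  have hlower : ε * K - ε * (η / 2) ≤ sSup S := by
    refine le_trans ?_ (le_csSup ⟨_, hub⟩ hmem)
    have h2 := norm_le_norm_add_norm_sub (f (h + v) - f h) (M *ᵥ v)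
    linarith [herr v hv]
  have hdiff : ε⁻¹ * sSup S - K = ε⁻¹ * (sSup S - ε * K) := by field_simp
  rw [Real.dist_eq, hdiff, abs_mul, abs_of_pos (inv_pos.2 hε0)]
  calc _ ≤ ε⁻¹ * (ε * (η / 2)) := by
        gcongr
        exact abs_le.2 ⟨by linarith, by linarith⟩
    _ = η / 2 := by field_simp
    _ < η := half_lt_self hη

/-- Mixed condition number of the TTLS solution: if `f` is Fréchet differentiable at
`[A b]` with derivative `ΔH ↦ M·vec(ΔH)` and `x = f([A b])` has `‖x‖_∞ ≠ 0`, then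
`lim_{ε→0⁺} sup_{|ΔH| ≤ ε|[A b]|} ‖f([A b]+ΔH) − f([A b])‖_∞/(ε‖x‖_∞)
  = ‖|M| vec([|A| |b|])‖_∞ / ‖x‖_∞`. -/
theorem mixed_condition_number_TTLS {m n : ℕ}
    (A : Matrix (Fin m) (Fin n) ℝ) (b : Fin m → ℝ)
    (f : (Fin m × Fin (n + 1) → ℝ) → (Fin n → ℝ))
    (M : Matrix (Fin n) (Fin m × Fin (n + 1)) ℝ)
    (L : (Fin m × Fin (n + 1) → ℝ) →L[ℝ] (Fin n → ℝ))
    (hL : ∀ ΔH, L ΔH = M *ᵥ ΔH)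
    (hf : HasFDerivAt f L (augVec A b))
    (x : Fin n → ℝ) (hxdef : x = f (augVec A b)) (hx : ‖x‖ ≠ 0) :
    Tendsto
      (fun ε : ℝ =>
        (1 / (ε * ‖x‖)) *
          sSup { r : ℝ | ∃ ΔH : Fin m × Fin (n + 1) → ℝ,
            (∀ p, |ΔH p| ≤ ε * |augVec A b p|) ∧
            r = ‖f (augVec A b + ΔH) - f (augVec A b)‖ })
      (nhdsWithin 0 (Set.Ioi 0))
      (nhds (‖(M.map fun y => |y|) *ᵥ fun p => |augVec A b p|‖ / ‖x‖)) := by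
  rw [div_eq_mul_inv]
  convert (tendsto_sSup_relative_perturbation hL hf).mul_const ‖x‖⁻¹ using 2 with ε
  rw [one_div, mul_inv]
  ring
end

section
/- Let f : ℝ^{m×(n+1)} → ℝ^n be Fréchet differentiable at H₀ = [A b] with derivative ΔH ↦ M·vec(ΔH) for some matrix M ∈ ℝ^{n×m(n+1)}, and suppose every entry of x = f(H₀) is nonzero. Then the limit as ε → 0⁺ of (1/ε)·sup{ ‖(f(H₀+ΔH) − f(H₀))/x‖_∞ : ΔH ∈ ℝ^{m×(n+1)}, |ΔH| ≤ ε|H₀| entrywise } exists and equals ‖ (|M|·vec([|A| |b|]))/x ‖_∞, where the division of vectors is entrywise. (This is the explicit expression for the componentwise condition number c(A,b) of the truncated total least squares solution, where f = ψ_k and M = M_k is its Fréchet derivative matrix.) -/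
open Matrix Filter

open scoped Pointwise

/-- The supremum of the norm of the increments of `g` over the scaled sets `ε • S` grows, to first
order in `ε`, like the maximum over `S` of the norm of the derivative. -/
theorem HasFDerivAt.tendsto_sSup_norm_sub {E F : Type*} [NormedAddCommGroup E] [NormedSpace ℝ E]
    [NormedAddCommGroup F] [NormedSpace ℝ F] {g : E → F} {L : E →L[ℝ] F} {h : E}
    (hg : HasFDerivAt g L h) {S : Set E} (hS : Bornology.IsBounded S) {K : ℝ}
    (hK : IsGreatest ((fun d => ‖L d‖) '' S) K) :
    Tendsto (fun ε : ℝ => (1 / ε) * sSup ((fun d => ‖g (h + d) - g h‖) '' (ε • S)))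
      (nhdsWithin 0 (Set.Ioi 0)) (nhds K) := by
  obtain ⟨R, hR0, hR⟩ := hS.exists_pos_norm_le
  obtain ⟨⟨d₀, hd₀, hd₀K⟩, hmax⟩ := hK
  rw [Metric.tendsto_nhds]
  intro η hη
  have hc : 0 < η / (2 * R) := by positivity
  have hlin := (hasFDerivAt_iff_isLittleO_nhds_zero.1 hg).def hc
  obtain ⟨δ, hδ, hball⟩ := Metric.eventually_nhds_iff.1 hlin
  have hsmall : ∀ᶠ ε : ℝ in nhdsWithin 0 (Set.Ioi 0), ε < δ / R :=
    nhdsWithin_le_nhds (eventually_lt_nhds (by positivity))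
  filter_upwards [hsmall, self_mem_nhdsWithin] with ε hεδ hε
  replace hε : 0 < ε := hε
  have hest : ∀ d ∈ S, ‖g (h + ε • d) - g h - ε • L d‖ ≤ ε * (η / 2) := by
    intro d hd
    have hnorm : ‖ε • d‖ ≤ ε * R := by
      rw [norm_smul, Real.norm_of_nonneg hε.le]
      exact mul_le_mul_of_nonneg_left (hR d hd) hε.le
    have hlt : dist (ε • d) 0 < δ := by
      rw [dist_zero_right]
      exact hnorm.trans_lt ((lt_div_iff₀ hR0).1 hεδ)
    have hbd := hball hlt
    rw [map_smul] at hbd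
    calc _ ≤ η / (2 * R) * ‖ε • d‖ := hbd
      _ ≤ η / (2 * R) * (ε * R) := mul_le_mul_of_nonneg_left hnorm hc.le
      _ = ε * (η / 2) := by field_simp
  have hnormL : ∀ d, ‖ε • L d‖ = ε * ‖L d‖ := fun d => by
    rw [norm_smul, Real.norm_of_nonneg hε.le]
  have hupper : ∀ r ∈ (fun d => ‖g (h + d) - g h‖) '' (ε • S), r ≤ ε * (K + η / 2) := by
    rintro _ ⟨_, ⟨d, hd, rfl⟩, rfl⟩
    have h2 := mul_le_mul_of_nonneg_left (hmax ⟨d, hd, rfl⟩) hε.le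
    have h3 := hest d hd
    have h4 := norm_sub_norm_le (g (h + ε • d) - g h) (ε • L d)
    rw [hnormL] at h4
    simp only at h2 ⊢
    linarith
  have hlower : ε * (K - η / 2) ≤ sSup ((fun d => ‖g (h + d) - g h‖) '' (ε • S)) := by
    refine le_csSup_of_le ⟨_, hupper⟩ ⟨_, Set.smul_mem_smul_set hd₀, rfl⟩ ?_
    have h3 := hest d₀ hd₀
    have h4 := norm_sub_norm_le (ε • L d₀) (g (h + ε • d₀) - g h)
    rw [norm_sub_rev (ε • L d₀), hnormL] at h4
    simp only at hd₀K ⊢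
    rw [hd₀K] at h4
    linarith
  have hsup := csSup_le (Set.Nonempty.image _ ⟨_, Set.smul_mem_smul_set hd₀⟩) hupper
  rw [Real.dist_eq, one_div, ← div_eq_inv_mul]
  have h5 := (div_le_iff₀' hε).2 hsup
  have h6 := (le_div_iff₀' hε).2 hlower
  rw [abs_lt]
  constructor <;> linarith

/-- The maximum norm of `N *ᵥ d` over the box `|d| ≤ |h|` is the norm of `|N| *ᵥ |h|`. -/
theorem Matrix.isGreatest_norm_mulVec_box {ι κ : Type*} [Fintype ι] [Fintype κ]
    (N : Matrix κ ι ℝ) (h : ι → ℝ) :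
    IsGreatest ((fun d => ‖N *ᵥ d‖) '' {d | ∀ p, |d p| ≤ |h p|})
      ‖fun i => ∑ p, |N i p| * |h p|‖ := by
  have hle : ∀ d : ι → ℝ, (∀ p, |d p| ≤ |h p|) →
      ‖N *ᵥ d‖ ≤ ‖fun i => ∑ p, |N i p| * |h p|‖ := by
    intro d hd
    refine (pi_norm_le_iff_of_nonneg (norm_nonneg _)).2 fun i => ?_
    refine le_trans ?_ (norm_le_pi_norm (fun i => ∑ p, |N i p| * |h p|) i)
    refine le_trans ?_ (le_abs_self _)
    refine (Finset.abs_sum_le_sum_abs _ _).trans (Finset.sum_le_sum fun p _ => ?_)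
    rw [abs_mul]
    exact mul_le_mul_of_nonneg_left (hd p) (abs_nonneg _)
  refine ⟨?_, by rintro _ ⟨d, hd, rfl⟩; exact hle d hd⟩
  cases isEmpty_or_nonempty κ
  · exact ⟨0, by simp, by simp [Subsingleton.elim _ (0 : κ → ℝ)]⟩
  obtain ⟨i, hi⟩ := Finite.exists_max fun i => ‖∑ p, |N i p| * |h p|‖
  have hbox : ∀ p, |(SignType.sign (N i p) : ℝ) * abs (h p)| ≤ |h p| := by
    intro p
    rw [abs_mul, abs_abs]
    refine mul_le_of_le_one_left (abs_nonneg _) ?_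
    rcases lt_trichotomy (N i p) 0 with hp | hp | hp <;> simp [hp]
  refine ⟨_, hbox, le_antisymm (hle _ hbox) ?_⟩
  refine (pi_norm_le_iff_of_nonneg (norm_nonneg _)).2 fun j => (hi j).trans ?_
  refine le_trans (le_of_eq ?_) (norm_le_pi_norm _ i)
  simp only [mulVec, dotProduct, ← mul_assoc, self_mul_sign]

/-- Componentwise condition number of the TTLS solution: if `f` is Fréchet differentiable
at `[A b]` with derivative `ΔH ↦ M·vec(ΔH)` and every entry of `x = f([A b])` is nonzero,
then `lim_{ε→0⁺} sup_{|ΔH| ≤ ε|[A b]|} (1/ε)‖(f([A b]+ΔH) − f([A b]))/x‖_∞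
  = ‖(|M| vec([|A| |b|]))/x‖_∞`, quotients taken entrywise. -/
theorem componentwise_condition_number_TTLS {m n : ℕ}
    (A : Matrix (Fin m) (Fin n) ℝ) (b : Fin m → ℝ)
    (f : (Fin m × Fin (n + 1) → ℝ) → (Fin n → ℝ))
    (M : Matrix (Fin n) (Fin m × Fin (n + 1)) ℝ)
    (L : (Fin m × Fin (n + 1) → ℝ) →L[ℝ] (Fin n → ℝ))
    (hL : ∀ ΔH, L ΔH = M *ᵥ ΔH)
    (hf : HasFDerivAt f L (augVec A b))
    (x : Fin n → ℝ) (hxdef : x = f (augVec A b)) (hx : ∀ i, x i ≠ 0) :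
    Tendsto
      (fun ε : ℝ =>
        (1 / ε) *
          sSup { r : ℝ | ∃ ΔH : Fin m × Fin (n + 1) → ℝ,
            (∀ p, |ΔH p| ≤ ε * |augVec A b p|) ∧
            r = ‖fun i => (f (augVec A b + ΔH) i - f (augVec A b) i) / x i‖ })
      (nhdsWithin 0 (Set.Ioi 0))
      (nhds ‖fun i => ((M.map fun y => |y|) *ᵥ fun p => |augVec A b p|) i / x i‖) := by
  let D : (Fin n → ℝ) →L[ℝ] (Fin n → ℝ) :=
    ContinuousLinearMap.pi fun i => (x i)⁻¹ • ContinuousLinearMap.proj i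
  have hD := (D.hasFDerivAt (x := f (augVec A b))).comp _ hf
  set h := augVec A b
  let N : Matrix (Fin n) (Fin m × Fin (n + 1)) ℝ := Matrix.of fun i p => (x i)⁻¹ * M i p
  have hmax := N.isGreatest_norm_mulVec_box h
  have hbdd : Bornology.IsBounded {d : Fin m × Fin (n + 1) → ℝ | ∀ p, |d p| ≤ |h p|} :=
    isBounded_iff_forall_norm_le.2 ⟨‖h‖, fun d hd =>
      (pi_norm_le_iff_of_nonneg (norm_nonneg _)).2 fun p => (hd p).trans (norm_le_pi_norm h p)⟩
  have hK : ‖fun i => ∑ p, |N i p| * |h p|‖ =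
      ‖fun i => ((M.map fun y => |y|) *ᵥ fun p => |h p|) i / x i‖ := by
    simp only [Pi.norm_def]
    congr 2
    funext i
    ext
    have hnn : 0 ≤ ∑ p, |M i p| * |h p| := by positivity
    simp only [N, of_apply, abs_mul, abs_inv, mul_assoc, ← Finset.mul_sum, coe_nnnorm, norm_mul,
      norm_inv, norm_div, mulVec, dotProduct, map_apply, Real.norm_eq_abs, abs_abs]
    rw [div_eq_inv_mul]
  rw [hK] at hmax
  have hN : ∀ d, N *ᵥ d = (D.comp L) d := fun d => by
    ext i
    simp [D, hL, N, mulVec, dotProduct, mul_assoc, Finset.mul_sum]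
  simp only [hN] at hmax
  refine (hD.tendsto_sSup_norm_sub hbdd hmax).congr' ?_
  filter_upwards [self_mem_nhdsWithin] with ε hε
  replace hε : 0 < ε := hε
  congr 2
  ext r
  simp only [Set.mem_image, Set.mem_ofPred_eq, Set.mem_smul_set_iff_inv_smul_mem₀ hε.ne']
  refine exists_congr fun d => and_congr (forall_congr' fun p => ?_) ?_
  · rw [Pi.smul_apply, smul_eq_mul, abs_mul, abs_inv, abs_of_pos hε, inv_mul_le_iff₀ hε]
  · rw [eq_comm]
    refine Eq.congr rfl (congrArg _ ?_)
    ext i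
    simp [D, div_eq_inv_mul, mul_sub]
end

section
/- Let S₁,…,S_t ∈ ℝ^{m×n} and Φ = [vec(S₁),…,vec(S_t)] ∈ ℝ^{mn×t}. Let f : ℝ^t × ℝ^m → ℝ^n be Fréchet differentiable at (a,b) with derivative (Δa,Δb) ↦ M·[Φ·Δa; Δb] for some matrix M ∈ ℝ^{n×(mn+m)}, and suppose x = f(a,b) has ‖x‖_∞ ≠ 0. Then the limit as ε → 0⁺ of (1/(ε‖x‖_∞))·sup{ ‖f((a,b)+(Δa,Δb)) − f(a,b)‖_∞ : |Δa| ≤ ε|a| and |Δb| ≤ ε|b| entrywise } exists and equals ‖ |M·blkdiag(Φ, I_m)|·[|a|; |b|] ‖_∞ / ‖x‖_∞. (This is the explicit expression for the structured mixed condition number m_s(a,b) of the structured truncated total least squares solution.) -/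
open Matrix Filter

/-- If `f` has derivative `L` at `w` and `B` is bounded, then the normalized worst-case variation of
`f` over the scaled perturbation set `ε • B` tends to the supremum of `‖L d‖` over `d ∈ B`. -/
theorem HasFDerivAt.tendsto_inv_mul_sSup_norm_sub {E F : Type*} [NormedAddCommGroup E]
    [NormedSpace ℝ E] [NormedAddCommGroup F] [NormedSpace ℝ F] {f : E → F} {L : E →L[ℝ] F}
    {w : E} (hf : HasFDerivAt f L w) {B : Set E} (hB : Bornology.IsBounded B) {κ : ℝ}
    (hκ : IsLUB ((fun d => ‖L d‖) '' B) κ) :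
    Tendsto (fun ε : ℝ => ε⁻¹ * sSup ((fun d => ‖f (w + ε • d) - f w‖) '' B))
      (nhdsWithin 0 (Set.Ioi 0)) (nhds κ) := by
  obtain ⟨R, hR, hBR⟩ := hB.exists_pos_norm_le
  have hne : B.Nonempty := by
    have := hκ.nonempty
    simpa using this
  rw [Metric.tendsto_nhds]
  intro η hη
  obtain ⟨ρ, hρ, hρf⟩ := Metric.eventually_nhds_iff.1
    ((hasFDerivAt_iff_isLittleO_nhds_zero.1 hf).def (show 0 < η / 2 / R by positivity))
  filter_upwards [Ioo_mem_nhdsGT (show 0 < ρ / R by positivity)] with ε hε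
  obtain ⟨hε0, hε1⟩ := hε
  have key : ∀ d ∈ B, ‖f (w + ε • d) - f w - ε • L d‖ ≤ η / 2 * ε := by
    intro d hd
    have hn : ‖ε • d‖ ≤ ε * R := by
      rw [norm_smul, Real.norm_of_nonneg hε0.le]
      gcongr
      exact hBR d hd
    have h := hρf (y := ε • d) (by
      rw [dist_zero_right]
      exact hn.trans_lt ((lt_div_iff₀ hR).1 hε1))
    rw [map_smul] at h
    calc _ ≤ η / 2 / R * ‖ε • d‖ := h
      _ ≤ η / 2 / R * (ε * R) := by gcongr
      _ = η / 2 * ε := by field_simp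
  have hnorm : ∀ d, ‖ε • L d‖ = ε * ‖L d‖ := fun d => by
    rw [norm_smul, Real.norm_of_nonneg hε0.le]
  have hub : ∀ y ∈ (fun d => ‖f (w + ε • d) - f w‖) '' B, y ≤ ε * (κ + η / 2) := by
    rintro _ ⟨d, hd, rfl⟩
    have h1 := norm_le_norm_add_norm_sub' (f (w + ε • d) - f w) (ε • L d)
    have h2 : ‖L d‖ ≤ κ := hκ.1 ⟨d, hd, rfl⟩
    have h3 := mul_le_mul_of_nonneg_left h2 hε0.le
    rw [hnorm] at h1
    have h4 := key d hd
    dsimp only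
    linarith
  have hle := csSup_le (hne.image _) hub
  have hge : κ ≤ ε⁻¹ * sSup ((fun d => ‖f (w + ε • d) - f w‖) '' B) + η / 2 := by
    refine hκ.2 ?_
    rintro _ ⟨d, hd, rfl⟩
    have h1 := norm_le_norm_add_norm_sub (f (w + ε • d) - f w) (ε • L d)
    have h2 := le_csSup ⟨_, hub⟩ (Set.mem_image_of_mem _ hd)
    rw [hnorm] at h1
    have h4 := key d hd
    refine le_of_mul_le_mul_left ?_ hε0
    rw [mul_add, mul_inv_cancel_left₀ hε0.ne']
    dsimp only at h2 ⊢
    linarith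
  have hle' := (inv_mul_le_iff₀ hε0).2 hle
  rw [Real.dist_eq, abs_lt]
  constructor <;> linarith

/-- The largest sup norm of `A *ᵥ d` over the box `|d| ≤ |c|` is the sup norm of `|A| *ᵥ |c|`. -/
theorem Matrix.isGreatest_norm_mulVec_abs_le {p q : Type*} [Fintype p] [Fintype q]
    (A : Matrix p q ℝ) (c : q → ℝ) :
    IsGreatest ((fun d => ‖A *ᵥ d‖) '' {d | ∀ j, |d j| ≤ |c j|})
      ‖(A.map fun y => |y|) *ᵥ fun j => |c j|‖ := by
  have hub : ∀ d : q → ℝ, (∀ j, |d j| ≤ |c j|) →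
      ‖A *ᵥ d‖ ≤ ‖(A.map fun y => |y|) *ᵥ fun j => |c j|‖ := by
    intro d hd
    refine (pi_norm_le_iff_of_nonneg (norm_nonneg _)).2 fun i => ?_
    refine le_trans ?_ ((Real.le_norm_self _).trans
      (norm_le_pi_norm ((A.map fun y => |y|) *ᵥ fun j => |c j|) i))
    simp only [mulVec, dotProduct, map_apply, Real.norm_eq_abs]
    refine (Finset.abs_sum_le_sum_abs _ _).trans (Finset.sum_le_sum fun j _ => ?_)
    rw [abs_mul]
    exact mul_le_mul_of_nonneg_left (hd j) (abs_nonneg _)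
  refine ⟨?_, by rintro _ ⟨d, hd, rfl⟩; exact hub d hd⟩
  rcases isEmpty_or_nonempty p with hp | hp
  · exact ⟨0, by simp, by simp [Subsingleton.elim (A *ᵥ 0) 0,
      Subsingleton.elim ((A.map fun y => |y|) *ᵥ fun j => |c j|) 0]⟩
  obtain ⟨i, hi⟩ := Finite.exists_max fun i => ‖((A.map fun y => |y|) *ᵥ fun j => |c j|) i‖
  have hd : ∀ j, abs (SignType.sign (A i j) * |c j|) ≤ |c j| := by
    intro j
    rw [abs_mul, abs_abs]
    refine mul_le_of_le_one_left (abs_nonneg _) ?_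
    rcases SignType.sign (A i j) with _ | _ | _ <;> simp
  refine ⟨fun j => SignType.sign (A i j) * |c j|, hd, le_antisymm (hub _ hd) ?_⟩
  refine (pi_norm_le_iff_of_nonneg (norm_nonneg _)).2 fun k => (hi k).trans ?_
  refine le_of_eq_of_le ?_ (norm_le_pi_norm _ i)
  simp only [mulVec, dotProduct, map_apply, ← mul_assoc, self_mul_sign]

/-- Structured mixed condition number of the STTLS solution: if `f` is Fréchet
differentiable at `(a,b)` with derivative `(Δa,Δb) ↦ M·[Φ·Δa; Δb]`, where
`Φ = [vec(S₁),…,vec(S_t)]`, and `x = f(a,b)` has `‖x‖_∞ ≠ 0`, then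
`lim_{ε→0⁺} sup_{|Δa| ≤ ε|a|, |Δb| ≤ ε|b|} ‖f((a,b)+(Δa,Δb)) − f(a,b)‖_∞/(ε‖x‖_∞)
  = ‖|M·blkdiag(Φ, I_m)|·[|a|;|b|]‖_∞ / ‖x‖_∞`. -/
theorem structured_mixed_condition_number_STTLS {m n t : ℕ}
    (S : Fin t → Matrix (Fin m) (Fin n) ℝ)
    (Φ : Matrix (Fin m × Fin n) (Fin t) ℝ)
    (hΦ : ∀ p i, Φ p i = S i p.1 p.2)
    (f : (Fin t → ℝ) × (Fin m → ℝ) → (Fin n → ℝ))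
    (a : Fin t → ℝ) (b : Fin m → ℝ)
    (M : Matrix (Fin n) ((Fin m × Fin n) ⊕ Fin m) ℝ)
    (L : ((Fin t → ℝ) × (Fin m → ℝ)) →L[ℝ] (Fin n → ℝ))
    (hL : ∀ Δ : (Fin t → ℝ) × (Fin m → ℝ), L Δ = M *ᵥ Sum.elim (Φ *ᵥ Δ.1) Δ.2)
    (hf : HasFDerivAt f L (a, b))
    (x : Fin n → ℝ) (hxdef : x = f (a, b)) (hx : ‖x‖ ≠ 0) :
    Tendsto
      (fun ε : ℝ =>
        (1 / (ε * ‖x‖)) *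
          sSup { r : ℝ | ∃ Δa : Fin t → ℝ, ∃ Δb : Fin m → ℝ,
            (∀ i, |Δa i| ≤ ε * |a i|) ∧ (∀ j, |Δb j| ≤ ε * |b j|) ∧
            r = ‖f (a + Δa, b + Δb) - f (a, b)‖ })
      (nhdsWithin 0 (Set.Ioi 0))
      (nhds
        (‖((M * Matrix.fromBlocks Φ 0 0 (1 : Matrix (Fin m) (Fin m) ℝ)).map
              fun y => |y|) *ᵥ
            Sum.elim (fun i => |a i|) (fun j => |b j|)‖ / ‖x‖)) := by
  set A := M * Matrix.fromBlocks Φ 0 0 (1 : Matrix (Fin m) (Fin m) ℝ)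
  have hLA : ∀ Δ : (Fin t → ℝ) × (Fin m → ℝ), L Δ = A *ᵥ Sum.elim Δ.1 Δ.2 := by
    intro Δ
    rw [hL, ← mulVec_mulVec, fromBlocks_mulVec]
    simp
  let B : Set ((Fin t → ℝ) × (Fin m → ℝ)) :=
    {d | (∀ i, |d.1 i| ≤ |a i|) ∧ ∀ j, |d.2 j| ≤ |b j|}
  have hB : Bornology.IsBounded B := by
    refine isBounded_iff_forall_norm_le.2 ⟨‖(a, b)‖, fun d hd => ?_⟩
    exact norm_prod_le_iff.2
      ⟨(pi_norm_le_iff_of_nonneg (norm_nonneg _)).2 fun i =>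
        (hd.1 i).trans ((norm_le_pi_norm a i).trans (norm_fst_le (a, b))),
      (pi_norm_le_iff_of_nonneg (norm_nonneg _)).2 fun j =>
        (hd.2 j).trans ((norm_le_pi_norm b j).trans (norm_snd_le (a, b)))⟩
  have himage : (fun d => ‖L d‖) '' B =
      (fun d => ‖A *ᵥ d‖) '' {d | ∀ j, |d j| ≤ |Sum.elim a b j|} := by
    ext r
    constructor
    · rintro ⟨d, hd, rfl⟩
      exact ⟨Sum.elim d.1 d.2, Sum.forall.2 hd, by simp only [hLA]⟩
    · rintro ⟨d, hd, rfl⟩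
      exact ⟨(d ∘ Sum.inl, d ∘ Sum.inr), Sum.forall.1 hd, by
        simp only [hLA, Sum.elim_comp_inl_inr]⟩
  have habs : (fun j => |Sum.elim a b j|) = Sum.elim (fun i => |a i|) fun j => |b j| := by
    ext j
    cases j <;> rfl
  have hκ := (A.isGreatest_norm_mulVec_abs_le (Sum.elim a b)).isLUB
  rw [← himage, habs] at hκ
  refine ((hf.tendsto_inv_mul_sSup_norm_sub hB hκ).div_const ‖x‖).congr' ?_
  filter_upwards [self_mem_nhdsWithin] with ε hε
  have hε0 : 0 < ε := hε
  have hscale : ∀ u v : ℝ, |u| ≤ ε * |v| ↔ |ε⁻¹ * u| ≤ |v| := fun u v => by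
    rw [abs_mul, abs_of_pos (inv_pos.2 hε0), inv_mul_le_iff₀ hε0]
  have hset : (fun d => ‖f ((a, b) + ε • d) - f (a, b)‖) '' B =
      { r : ℝ | ∃ Δa : Fin t → ℝ, ∃ Δb : Fin m → ℝ,
        (∀ i, |Δa i| ≤ ε * |a i|) ∧ (∀ j, |Δb j| ≤ ε * |b j|) ∧
        r = ‖f (a + Δa, b + Δb) - f (a, b)‖ } := by
    ext r
    simp only [hscale]
    constructor
    · rintro ⟨d, hd, rfl⟩
      refine ⟨ε • d.1, ε • d.2, ?_, ?_, rfl⟩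
      · simpa [inv_mul_cancel_left₀ hε0.ne'] using hd.1
      · simpa [inv_mul_cancel_left₀ hε0.ne'] using hd.2
    · rintro ⟨Δa, Δb, ha, hb, rfl⟩
      exact ⟨(ε⁻¹ • Δa, ε⁻¹ • Δb), ⟨ha, hb⟩, by simp [smul_smul, mul_inv_cancel₀ hε0.ne']⟩
  rw [hset]
  field_simp
end

section
/- Let S₁,…,S_t ∈ ℝ^{m×n}, a ∈ ℝ^t, A = Σ_{i=1}^t a_i S_i, and suppose |A| = Σ_{i=1}^t |a_i| |S_i| (entrywise). Let Φ = [vec(S₁),…,vec(S_t)] ∈ ℝ^{mn×t}, b ∈ ℝ^m, and let M ∈ ℝ^{n×(mn+m)} be arbitrary. Then the entrywise vector inequality | M·blkdiag(Φ, I_m) |·[|a|; |b|] ≤ |M|·[vec(|A|); |b|] holds. Consequently, ‖ |M·blkdiag(Φ, I_m)|·[|a|;|b|] ‖_∞ ≤ ‖ |M|·[vec(|A|);|b|] ‖_∞, and, for any vector x ∈ ℝ^n with all entries nonzero, ‖ (|M·blkdiag(Φ, I_m)|·[|a|;|b|])/x ‖_∞ ≤ ‖ (|M|·[vec(|A|);|b|])/x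 ‖_∞. (With M = M_k and x = x_k this states that the structured mixed and componentwise condition numbers of the truncated total least squares problem are bounded by the unstructured ones: m_s(a,b) ≤ m(A,b) and c_s(a,b) ≤ c(A,b).) -/
open Matrix

/-- The entrywise absolute value is submultiplicative when applied to a nonnegative vector. -/
theorem map_abs_mul_mulVec_le {l k r : Type*} [Fintype k] [Fintype r]
    (M : Matrix l k ℝ) (N : Matrix k r ℝ) {v : r → ℝ} (hv : 0 ≤ v) :
    ((M * N).map fun y => |y|) *ᵥ v ≤
      (M.map fun y => |y|) *ᵥ ((N.map fun y => |y|) *ᵥ v) := by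
  rw [mulVec_mulVec]
  intro i
  refine Finset.sum_le_sum fun j _ => mul_le_mul_of_nonneg_right ?_ (hv j)
  simp only [map_apply, mul_apply, ← abs_mul]
  exact Finset.abs_sum_le_sum_abs _ _

theorem map_abs_mulVec_nonneg {l k : Type*} [Fintype k] (M : Matrix l k ℝ) {v : k → ℝ}
    (hv : 0 ≤ v) : 0 ≤ (M.map fun y => |y|) *ᵥ v :=
  fun _ => Finset.sum_nonneg fun j _ => mul_nonneg (abs_nonneg _) (hv j)

/-- The supremum norm is monotone in the entrywise absolute values. -/
theorem pi_norm_le_of_abs_le {ι : Type*} [Fintype ι] {u v : ι → ℝ} (h : ∀ i, |u i| ≤ |v i|) :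
    ‖u‖ ≤ ‖v‖ :=
  (pi_norm_le_iff_of_nonneg (norm_nonneg v)).2 fun i => (h i).trans (norm_le_pi_norm v i)

/-- Structured vs unstructured mixed and componentwise condition numbers for the TTLS
problem: if `A = Σ aᵢ Sᵢ` and `|A| = Σ |aᵢ| |Sᵢ|`, then with `Φ = [vec(S₁),…,vec(S_t)]`
one has the entrywise inequality
`|M·blkdiag(Φ, I_m)|·[|a|;|b|] ≤ |M|·[vec(|A|); |b|]`,
and consequently the corresponding `‖·‖_∞` bound and, for any entrywise nonzero `x`,
the bound for the entrywise quotients by `x`. -/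
theorem structured_le_unstructured_mixed_componentwise {m n t : ℕ}
    (S : Fin t → Matrix (Fin m) (Fin n) ℝ) (a : Fin t → ℝ)
    (A : Matrix (Fin m) (Fin n) ℝ)
    (hA : A = ∑ i, a i • S i)
    (habs : A.map (fun y => |y|) = ∑ i, |a i| • (S i).map (fun y => |y|))
    (Φ : Matrix (Fin m × Fin n) (Fin t) ℝ)
    (hΦ : ∀ p i, Φ p i = S i p.1 p.2)
    (b : Fin m → ℝ)
    (M : Matrix (Fin n) ((Fin m × Fin n) ⊕ Fin m) ℝ) :
    (∀ i : Fin n,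
      (((M * Matrix.fromBlocks Φ 0 0 (1 : Matrix (Fin m) (Fin m) ℝ)).map fun y => |y|) *ᵥ
          Sum.elim (fun j => |a j|) (fun l => |b l|)) i ≤
        ((M.map fun y => |y|) *ᵥ
          Sum.elim (fun p : Fin m × Fin n => |A p.1 p.2|) (fun l => |b l|)) i) ∧
    ‖((M * Matrix.fromBlocks Φ 0 0 (1 : Matrix (Fin m) (Fin m) ℝ)).map fun y => |y|) *ᵥ
        Sum.elim (fun j => |a j|) (fun l => |b l|)‖ ≤
      ‖(M.map fun y => |y|) *ᵥ
        Sum.elim (fun p : Fin m × Fin n => |A p.1 p.2|) (fun l => |b l|)‖ ∧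
    ∀ x : Fin n → ℝ, (∀ i, x i ≠ 0) →
      ‖fun i =>
          ((((M * Matrix.fromBlocks Φ 0 0 (1 : Matrix (Fin m) (Fin m) ℝ)).map
                fun y => |y|) *ᵥ
              Sum.elim (fun j => |a j|) (fun l => |b l|)) i) / x i‖ ≤
        ‖fun i =>
          (((M.map fun y => |y|) *ᵥ
              Sum.elim (fun p : Fin m × Fin n => |A p.1 p.2|) (fun l => |b l|)) i) / x i‖ := by
  have hnonneg : 0 ≤ Sum.elim (fun j => |a j|) (fun l => |b l|) := by
    rintro (j | l) <;> exact abs_nonneg _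
  have hblk : ((fromBlocks Φ 0 0 (1 : Matrix (Fin m) (Fin m) ℝ)).map fun y => |y|) *ᵥ
      Sum.elim (fun j => |a j|) (fun l => |b l|) =
      Sum.elim (fun p : Fin m × Fin n => |A p.1 p.2|) (fun l => |b l|) := by
    ext (p | l)
    · have h := congrFun (congrFun habs p.1) p.2
      simp only [map_apply, Matrix.sum_apply, Matrix.smul_apply, smul_eq_mul] at h
      simp [mulVec, dotProduct, hΦ, h, mul_comm]
    · simp [mulVec, dotProduct, one_apply, apply_ite abs]
  have hle := map_abs_mul_mulVec_le M (fromBlocks Φ 0 0 (1 : Matrix (Fin m) (Fin m) ℝ)) hnonneg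
  have hpos := map_abs_mulVec_nonneg
    (M * fromBlocks Φ 0 0 (1 : Matrix (Fin m) (Fin m) ℝ)) hnonneg
  rw [hblk] at hle
  refine ⟨hle, pi_norm_le_of_abs_le fun i => abs_le_abs_of_nonneg (hpos i) (hle i),
    fun x _ => pi_norm_le_of_abs_le fun i => ?_⟩
  simp only [abs_div]
  exact div_le_div_of_nonneg_right (abs_le_abs_of_nonneg (hpos i) (hle i)) (abs_nonneg _)
end

section
/- Let A ∈ ℝ^{m×n} with m ≥ n+1 and b ∈ ℝ^m. Let σ_{n+1} > 0 be the smallest singular value of [A b] and assume the genericity condition σ̃_n > σ_{n+1}, where σ̃_n is the smallest singular value of A. Set P = A^⊤A − σ_{n+1}²I_n (positive definite), x = P^{-1}A^⊤b, r = b − Ax, and G(x) = [x^⊤, −1] ⊗ I_m ∈ ℝ^{m×(n+1)m}. Then: (i) A^⊤r = −σ_{n+1}² x and ‖r‖₂² = σ_{n+1}²(1 + ‖x‖₂²); and (ii) the matrix 𝒦 = P^{-1}( 2A^⊤(r r^⊤/‖r‖₂²)G(x) − A^⊤G(x) + [I_n ⊗ r^⊤, 0_{n×m}] ) equals P^{-1}[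 I_n ⊗ r^⊤ − x^⊤ ⊗ (A^⊤ + 2xr^⊤/(1+x^⊤x)), A^⊤ + 2xr^⊤/(1+x^⊤x) ]. Consequently the structured mixed condition number formula m_{s,n}(a,b) for the untruncated total least squares problem coincides with the truncated formula m_s(a,b) evaluated at truncation level k = n. -/
open Matrix

/-- `G(x) = [x^⊤, −1] ⊗ I_m ∈ ℝ^{m×(n+1)m}`, with columns indexed in blocks. -/
def Gmat {m n : ℕ} (x : Fin n → ℝ) : Matrix (Fin m) ((Fin n × Fin m) ⊕ Fin m) ℝ :=
  Matrix.of fun i c =>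
    Sum.elim (fun q : Fin n × Fin m => x q.1 * (if i = q.2 then (1 : ℝ) else 0))
      (fun j => -(if i = j then (1 : ℝ) else 0)) c

/-- `[I_n ⊗ r^⊤, 0_{n×m}] ∈ ℝ^{n×(mn+m)}`. -/
def Emat {m n : ℕ} (r : Fin m → ℝ) : Matrix (Fin n) ((Fin n × Fin m) ⊕ Fin m) ℝ :=
  Matrix.of fun a c =>
    Sum.elim (fun q : Fin n × Fin m => (if a = q.1 then (1 : ℝ) else 0) * r q.2)
      (fun _ => (0 : ℝ)) c

/-- `Q₂ = A^⊤ + 2xr^⊤/(1+x^⊤x)`. -/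
noncomputable def Q2mat {m n : ℕ} (A : Matrix (Fin m) (Fin n) ℝ) (x : Fin n → ℝ)
    (r : Fin m → ℝ) : Matrix (Fin n) (Fin m) ℝ :=
  Aᵀ + (2 / (1 + ∑ i, x i ^ 2)) • Matrix.vecMulVec x r

/-- `[I_n ⊗ r^⊤ − x^⊤ ⊗ Q₂, Q₂] ∈ ℝ^{n×(mn+m)}`. -/
noncomputable def Jmat {m n : ℕ} (A : Matrix (Fin m) (Fin n) ℝ) (x : Fin n → ℝ)
    (r : Fin m → ℝ) : Matrix (Fin n) ((Fin n × Fin m) ⊕ Fin m) ℝ :=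
  Matrix.of fun a c =>
    Sum.elim (fun q : Fin n × Fin m =>
        (if a = q.1 then (1 : ℝ) else 0) * r q.2 - x q.1 * Q2mat A x r a q.2)
      (fun j => Q2mat A x r a j) c

theorem neg_Q2mat_mul_Gmat_add_Emat {m n : ℕ} (A : Matrix (Fin m) (Fin n) ℝ) (x : Fin n → ℝ)
    (r : Fin m → ℝ) : -(Q2mat A x r * (Gmat x : Matrix (Fin m) _ ℝ)) + Emat r = Jmat A x r := by
  ext a c
  rcases c with q | j
  · simp [Matrix.mul_apply, Gmat, Emat, Jmat]
    ring
  · simp [Matrix.mul_apply, Gmat, Emat, Jmat]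

/-- TLS identities under the genericity condition `σ̃_n > σ_{n+1}`:
(i) `A^⊤r = −σ_{n+1}² x` and `‖r‖₂² = σ_{n+1}²(1+‖x‖₂²)`;
(ii) `𝒦 = P^{-1}(2A^⊤(rr^⊤/‖r‖²)G(x) − A^⊤G(x) + [I_n ⊗ r^⊤, 0])`
equals `P^{-1}[I_n ⊗ r^⊤ − x^⊤ ⊗ Q₂, Q₂]` with `Q₂ = A^⊤ + 2xr^⊤/(1+x^⊤x)`. -/
theorem TLS_residual_and_K_identity {m n : ℕ} (hmn : n + 1 ≤ m)
    (A : Matrix (Fin m) (Fin n) ℝ) (b : Fin m → ℝ)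
    (σ σt : ℝ) (hσpos : 0 < σ)
    (C : Matrix (Fin m) (Fin n ⊕ Fin 1) ℝ)
    (hC : C = Matrix.of fun i j => Sum.elim (fun jj => A i jj) (fun _ => b i) j)
    (hσ_ev : ∃ v : Fin n ⊕ Fin 1 → ℝ, v ≠ 0 ∧ (Cᵀ * C) *ᵥ v = σ ^ 2 • v)
    (hσ_min : ∀ μ : ℝ, (∃ v : Fin n ⊕ Fin 1 → ℝ, v ≠ 0 ∧ (Cᵀ * C) *ᵥ v = μ • v) →
      σ ^ 2 ≤ μ)
    (hσt_nonneg : 0 ≤ σt)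
    (hσt_ev : ∃ v : Fin n → ℝ, v ≠ 0 ∧ (Aᵀ * A) *ᵥ v = σt ^ 2 • v)
    (hσt_min : ∀ μ : ℝ, (∃ v : Fin n → ℝ, v ≠ 0 ∧ (Aᵀ * A) *ᵥ v = μ • v) → σt ^ 2 ≤ μ)
    (hgen : σ < σt)
    (P : Matrix (Fin n) (Fin n) ℝ) (hP : P = Aᵀ * A - σ ^ 2 • 1)
    (x : Fin n → ℝ) (hx : x = P⁻¹ *ᵥ (Aᵀ *ᵥ b))
    (r : Fin m → ℝ) (hr : r = b - A *ᵥ x) :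
    (Aᵀ *ᵥ r = (-σ ^ 2) • x ∧ ∑ i, r i ^ 2 = σ ^ 2 * (1 + ∑ i, x i ^ 2)) ∧
    P⁻¹ * ((2 : ℝ) • (Aᵀ * ((∑ i, r i ^ 2)⁻¹ • Matrix.vecMulVec r r) * Gmat x) -
        Aᵀ * Gmat x + Emat r) =
      P⁻¹ * Jmat A x r := by
  have hker : ∀ v : Fin n → ℝ, P *ᵥ v = 0 → v = 0 := by
    intro v hv
    by_contra hne
    rw [hP, Matrix.sub_mulVec, Matrix.smul_mulVec, Matrix.one_mulVec, sub_eq_zero] at hv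
    have := hσt_min (σ ^ 2) ⟨v, hne, hv⟩
    nlinarith
  have hdet : IsUnit P.det := by
    rw [isUnit_iff_ne_zero]
    intro h0
    obtain ⟨v, hv, hPv⟩ := Matrix.exists_mulVec_eq_zero_iff.mpr h0
    exact hv (hker v hPv)
  have hPx : P *ᵥ x = Aᵀ *ᵥ b := by
    rw [hx, Matrix.mulVec_mulVec, Matrix.mul_nonsing_inv P hdet, Matrix.one_mulVec]
  have hPmul : ∀ v, P *ᵥ v = Aᵀ *ᵥ (A *ᵥ v) - σ ^ 2 • v := by
    intro v
    rw [hP, Matrix.sub_mulVec, Matrix.smul_mulVec, Matrix.one_mulVec, Matrix.mulVec_mulVec]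
  have hAr : Aᵀ *ᵥ r = (-σ ^ 2) • x := by
    rw [hr, Matrix.mulVec_sub, ← hPx, hPmul, neg_smul]
    abel
  have hbr : b ⬝ᵥ r = σ ^ 2 := by
    obtain ⟨v, hv0, hv⟩ := hσ_ev
    obtain ⟨u, w, rfl⟩ : ∃ (u : Fin n → ℝ) (w : ℝ), v = Sum.elim u (fun _ => w) :=
      ⟨fun i => v (Sum.inl i), v (Sum.inr 0), by
        ext i
        rcases i with i | i
        · rfl
        · simp [Subsingleton.elim i 0]⟩
    have hCv : C *ᵥ Sum.elim u (fun _ => w) = A *ᵥ u + w • b := by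
      ext i
      simp [hC, Matrix.mulVec, dotProduct, mul_comm w]
    rw [← Matrix.mulVec_mulVec, hCv] at hv
    have htop : Aᵀ *ᵥ (A *ᵥ u + w • b) = σ ^ 2 • u := by
      ext i
      have := congrFun hv (Sum.inl i)
      simpa [hC, Matrix.mulVec, dotProduct] using this
    have hbot : b ⬝ᵥ (A *ᵥ u + w • b) = σ ^ 2 * w := by
      have := congrFun hv (Sum.inr 0)
      simpa [hC, Matrix.mulVec, dotProduct] using this
    have hu : u = -w • x := by
      rw [← sub_eq_zero]
      apply hker
      rw [Matrix.mulVec_sub, Matrix.mulVec_smul, hPx, hPmul, ← htop, Matrix.mulVec_add,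
        Matrix.mulVec_smul, neg_smul]
      abel
    have hw : w ≠ 0 := by
      rintro rfl
      apply hv0
      ext i
      rcases i with i | i <;> simp [hu]
    have hres : A *ᵥ u + w • b = w • r := by
      rw [hu, hr, Matrix.mulVec_smul, smul_sub, neg_smul]
      abel
    rw [hres, dotProduct_smul, smul_eq_mul, mul_comm] at hbot
    exact mul_right_cancel₀ hw hbot
  have hnorm : ∑ i, r i ^ 2 = σ ^ 2 * (1 + ∑ i, x i ^ 2) := by
    have hrr : ∑ i, r i ^ 2 = r ⬝ᵥ r := by simp [dotProduct, sq]
    have hxx : ∑ i, x i ^ 2 = x ⬝ᵥ x := by simp [dotProduct, sq]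
    have hrAx : r ⬝ᵥ (A *ᵥ x) = -σ ^ 2 * (x ⬝ᵥ x) := by
      rw [Matrix.dotProduct_mulVec, ← Matrix.mulVec_transpose, hAr, smul_dotProduct, smul_eq_mul]
    have hsplit : r ⬝ᵥ r = b ⬝ᵥ r - r ⬝ᵥ (A *ᵥ x) := by
      rw [dotProduct_comm b r, ← dotProduct_sub, ← hr]
    rw [hrr, hxx, hsplit, hbr, hrAx]
    ring
  refine ⟨⟨hAr, hnorm⟩, ?_⟩
  have hpos : 0 < 1 + ∑ i, x i ^ 2 := by positivity
  have hcoef : 2 * (σ ^ 2 * (1 + ∑ i, x i ^ 2))⁻¹ * (-σ ^ 2) = -(2 / (1 + ∑ i, x i ^ 2)) := by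
    field_simp
  have hQ : (2 : ℝ) • (Aᵀ * ((∑ i, r i ^ 2)⁻¹ • Matrix.vecMulVec r r)) - Aᵀ = -Q2mat A x r := by
    rw [Matrix.mul_smul, Matrix.mul_vecMulVec, hAr, Matrix.smul_vecMulVec, hnorm, smul_smul,
      smul_smul, hcoef, Q2mat, neg_smul]
    abel
  rw [← neg_Q2mat_mul_Gmat_add_Emat, ← Matrix.neg_mul, ← hQ, Matrix.sub_mul, Matrix.smul_mul]
  -- The products by `Gmat x` in the statement use the definitionally equal `CStarMatrix` instance.
  rfl
end

section
/- Let V ∈ ℝ^{(n+1)×(n+1)} be an orthogonal matrix partitioned as V = [V11 V12; V21 V22] with V11 ∈ ℝ^{n×n}, V12 ∈ ℝ^{n×1}, V21 ∈ ℝ^{1×n}, and scalar V22 ≠ 0. Then V11^⊤·( V11 − (1/V22)·V12·V21 ) = I_n. In particular V11 is invertible, with V11^{-1} = V11^⊤ − (1/V22)·... (equivalently, V11 − (1/V22)V12V21 is a right inverse of V11^⊤). -/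
open Matrix

/-- For an orthogonal matrix `V = [V11 V12; V21 V22]` with `V11 ∈ ℝ^{n×n}` and nonzero
scalar `V22`, one has `V11^⊤(V11 − (1/V22)V12V21) = I_n`; in particular `V11` is
invertible. -/
theorem orthogonal_block_identity {n : ℕ}
    (V11 : Matrix (Fin n) (Fin n) ℝ) (V12 : Matrix (Fin n) (Fin 1) ℝ)
    (V21 : Matrix (Fin 1) (Fin n) ℝ) (V22 : Matrix (Fin 1) (Fin 1) ℝ)
    (hV : (Matrix.fromBlocks V11 V12 V21 V22)ᵀ * Matrix.fromBlocks V11 V12 V21 V22 = 1)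
    (hV' : Matrix.fromBlocks V11 V12 V21 V22 * (Matrix.fromBlocks V11 V12 V21 V22)ᵀ = 1)
    (hv22 : V22 0 0 ≠ 0) :
    V11ᵀ * (V11 - (V22 0 0)⁻¹ • (V12 * V21)) = 1 ∧ IsUnit V11 := by
  rw [fromBlocks_transpose, fromBlocks_multiply, ← fromBlocks_one, fromBlocks_inj] at hV
  obtain ⟨h11, h12, -, -⟩ := hV
  have hV22 : V22 = V22 0 0 • (1 : Matrix (Fin 1) (Fin 1) ℝ) := by
    ext i j
    simp [Subsingleton.elim i 0, Subsingleton.elim j 0]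
  have hcol : V11ᵀ * V12 = -(V22 0 0 • V21ᵀ) := by
    rw [eq_neg_of_add_eq_zero_left h12]
    nth_rw 1 [hV22]
    rw [Matrix.mul_smul, Matrix.mul_one]
  have hinv : V11ᵀ * (V11 - (V22 0 0)⁻¹ • (V12 * V21)) = 1 := by
    rw [Matrix.mul_sub, Matrix.mul_smul, ← Matrix.mul_assoc, hcol, Matrix.neg_mul,
      Matrix.smul_mul, smul_neg, inv_smul_smul₀ hv22, sub_neg_eq_add, h11]
  exact ⟨hinv, (isUnit_transpose _).mp (IsUnit.of_mul_eq_one _ hinv)⟩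
end
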